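/- Suppose X ⊆ ℝ, k ≥ 2 is an integer, and ε > 0 with 1/(2ε) ∈ ℤ⁺, such that every arithmetic progression of length k and gap Δ > 0 contains a point at distance more than εΔ from X. Then for every compact interval J ⊆ ℝ, the set X ∩ J can be covered by at most (k−1)/(2ε) closed intervals each of length |J|·(2ε)/k. -/

import Mathlib

/-- If X ⊆ ℝ stays ε-far (relative to the gap) from every arithmetic progression
of length k, then X ∩ J is covered by at most (k−1)/(2ε) intervals of length
|J|·(2ε)/k, for any compact interval J. -/
theorem cover_of_avoiding_APs (X : Set ℝ)
    (k : ℕ) (hk : 2 ≤ k) (ε : ℝ) (hε : 0 < ε)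
    (hint : ∃ j : ℕ, 0 < j ∧ (j : ℝ) = 1 / (2 * ε))
    (havoid : ∀ x Δ : ℝ, 0 < Δ → ∃ i : ℕ, i < k ∧
      sInf {d : ℝ | ∃ y ∈ X, d = |x + i * Δ - y|} > ε * Δ) :
    ∀ a b : ℝ, a ≤ b → ∃ F : Finset ℝ,
      (F.card : ℝ) ≤ (k - 1) / (2 * ε) ∧
      X ∩ Set.Icc a b ⊆ ⋃ c ∈ F, Set.Icc c (c + (b - a) * (2 * ε) / k) := by
  intro a b hab
  obtain ⟨m, hm, hmε⟩ := hint
  have hk' : (2 : ℝ) ≤ k := by exact_mod_cast hk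
  have hm' : (1 : ℝ) ≤ m := by exact_mod_cast hm
  have hcard : ((k : ℝ) - 1) / (2 * ε) = m * (k - 1) := by rw [hmε]; ring
  rw [hcard]
  rcases hab.eq_or_lt with rfl | hlt
  · refine ⟨{a}, ?_, ?_⟩
    · simp only [Finset.card_singleton, Nat.cast_one]
      nlinarith
    · intro y hy
      have := hy.2
      simpa using this
  obtain ⟨L, hLdef⟩ : ∃ L : ℝ, L = (b - a) * (2 * ε) / k := ⟨_, rfl⟩
  have hkpos : (0 : ℝ) < k := by linarith
  have hL : 0 < L := by
    rw [hLdef]; exact div_pos (mul_pos (by linarith) (by linarith)) hkpos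
  have hme : (m : ℝ) * (2 * ε) = 1 := by rw [hmε]; field_simp
  have hba : b - a = k * m * L := by
    rw [hLdef]
    have : (k : ℝ) * m * ((b - a) * (2 * ε) / k) = (m * (2 * ε)) * (b - a) * (k / k) := by ring
    rw [this, hme, div_self hkpos.ne']; ring
  have hhalf : ε * (m * L) = L / 2 := by linear_combination L / 2 * hme
  rw [← hLdef]
  have hav : ∀ r : ℕ, ∃ i : ℕ, i < k ∧ ∀ y ∈ X,
      L / 2 < |a + (r + 1 / 2) * L + i * (m * L) - y| := by
    intro r
    obtain ⟨i, hi, h⟩ := havoid (a + (r + 1 / 2) * L) (m * L) (by positivity)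
    refine ⟨i, hi, fun y hy => ?_⟩
    rw [hhalf] at h
    refine lt_of_lt_of_le h (csInf_le ⟨0, ?_⟩ ⟨y, hy, rfl⟩)
    rintro d ⟨z, _, rfl⟩
    exact abs_nonneg _
  choose f hfk hf using hav
  refine ⟨((Finset.range m).sigma (fun r => (Finset.range k).erase (f r))).image
    (fun p => a + ((p.2 * m + p.1 : ℕ) : ℝ) * L), ?_, ?_⟩
  · have h1 : (((Finset.range m).sigma (fun r => (Finset.range k).erase (f r)))).card
        = m * (k - 1) := by
      rw [Finset.card_sigma, Finset.sum_congr rfl (g := fun _ => k - 1)]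
      · simp
      · intro r _
        rw [Finset.card_erase_of_mem (Finset.mem_range.2 (hfk r)), Finset.card_range]
    have h2 := Finset.card_image_le (s := (Finset.range m).sigma
      (fun r => (Finset.range k).erase (f r)))
      (f := fun p => a + ((p.2 * m + p.1 : ℕ) : ℝ) * L)
    rw [h1] at h2
    have h3 : ((m * (k - 1) : ℕ) : ℝ) = m * (k - 1) := by
      push_cast [Nat.cast_sub (show 1 ≤ k by omega)]; ring
    rw [← h3]
    exact_mod_cast h2
  · rintro y ⟨hyX, hya, hyb⟩
    obtain ⟨n, hn, h1, h2⟩ : ∃ n : ℕ, n < k * m ∧ a + n * L ≤ y ∧ y ≤ a + (n + 1) * L := by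
      obtain ⟨t, ht⟩ : ∃ t, t = (y - a) / L := ⟨_, rfl⟩
      have hy : y - a = t * L := by rw [ht]; field_simp
      have ht0 : 0 ≤ t := by rw [ht]; exact div_nonneg (by linarith) hL.le
      have htk : t ≤ ((k * m : ℕ) : ℝ) := by
        push_cast
        rw [ht, div_le_iff₀ hL]; linarith
      have hc : ⌈t⌉₊ ≤ k * m := Nat.ceil_le.2 htk
      have hpos : 0 < k * m := Nat.mul_pos (by omega) hm
      have hle := Nat.le_ceil t
      have hlt' := Nat.ceil_lt_add_one ht0
      rcases Nat.eq_zero_or_pos ⌈t⌉₊ with h0 | h0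
      · have : t ≤ 0 := Nat.ceil_eq_zero.1 h0
        have : t = 0 := le_antisymm this ht0
        subst this
        refine ⟨0, hpos, ?_, ?_⟩ <;> push_cast <;> nlinarith
      · obtain ⟨n, hn⟩ : ∃ n, ⌈t⌉₊ = n + 1 := ⟨⌈t⌉₊ - 1, by omega⟩
        rw [hn] at hle hlt' hc
        push_cast at hle hlt'
        refine ⟨n, by omega, ?_, ?_⟩ <;> nlinarith
    have hdm : n / m * m + n % m = n := Nat.div_add_mod' n m
    have hdm' : ((n / m : ℕ) : ℝ) * m + ((n % m : ℕ) : ℝ) = n := by exact_mod_cast hdm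
    have hne : n / m ≠ f (n % m) := by
      intro he
      have h := hf (n % m) y hyX
      rw [← he] at h
      have e : a + (((n % m : ℕ) : ℝ) + 1 / 2) * L + ((n / m : ℕ) : ℝ) * (m * L) - y
          = a + (n + 1 / 2) * L - y := by rw [← hdm']; ring
      rw [e] at h
      refine absurd h (not_lt.2 (abs_le.2 ⟨?_, ?_⟩)) <;> linarith
    simp only [Set.mem_iUnion]
    refine ⟨a + n * L, ?_, h1, by linarith⟩
    refine Finset.mem_image.2 ⟨⟨n % m, n / m⟩, ?_, ?_⟩
    · simp only [Finset.mem_sigma, Finset.mem_range, Finset.mem_erase]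
      exact ⟨Nat.mod_lt _ hm, hne, (Nat.div_lt_iff_lt_mul hm).2 hn⟩
    · simp only [hdm]
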